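/- arXiv:2401.16192 — 5 statements merged into one kernel-verified Lean document; each statement's English description precedes it below -/
import Mathlib

section
/- The effective metric κ_eff(x,y) = κ(x,y) + Σ_{i=1}^n Q_i(x)·Q_i(y) is a nondegenerate bilinear form on 𝔱. -/
/-- Setting: `𝕥` is a finite-dimensional complex vector space with a nondegenerate
symmetric bilinear form `κ` (with inverse `κ♯ = κs` of `κ♭`), and roots
`Q_1, …, Q_n ∈ 𝕥*` satisfying the Fundamental Identity `κ^∨(Q_i, Q_j) = Q_j (κ♯ (Q_i)) = 0`.

The effective metric `κ_eff(x, y) = κ(x, y) + Σ_i Q_i(x) · Q_i(y)` is a nondegenerate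
bilinear form on `𝕥`. -/
theorem stmt3 {𝕥 : Type*} [AddCommGroup 𝕥] [Module ℂ 𝕥] [FiniteDimensional ℂ 𝕥]
    (κ : 𝕥 →ₗ[ℂ] 𝕥 →ₗ[ℂ] ℂ) (hκsymm : ∀ x y, κ x y = κ y x)
    (hκnd : ∀ x, (∀ y, κ x y = 0) → x = 0)
    (κs : (𝕥 →ₗ[ℂ] ℂ) →ₗ[ℂ] 𝕥) (hκs : ∀ f x, κ (κs f) x = f x)
    {n : ℕ} (Q : Fin n → (𝕥 →ₗ[ℂ] ℂ)) (hFI : ∀ i j, Q j (κs (Q i)) = 0)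
    (keff : 𝕥 →ₗ[ℂ] 𝕥 →ₗ[ℂ] ℂ)
    (hkeff : ∀ x y, keff x y = κ x y + ∑ i : Fin n, Q i x * Q i y) :
    ∀ x, (∀ y, keff x y = 0) → x = 0 := by
  intro x hx
  have hQ (j : Fin n) : Q j x = 0 := by
    have h := hx (κs (Q j))
    simpa [hkeff, hFI, hκsymm x, hκs] using h
  refine hκnd x fun y => ?_
  simpa [hkeff, hQ] using hx y
end

section
/- Write κ_eff♭ : 𝔱 → 𝔱* for x ↦ κ_eff(x,−). For every f ∈ 𝔱* one has κ_eff♭( κ♯(f) − Σ_{i=1}^n κ^∨(Q_i,f)·κ♯(Q_i) ) = f. In particular κ_eff♭ is invertible and the dual form of the effective metric satisfies κ_eff^∨(f,g) = κ^∨(f,g) − Σ_{i=1}^n κ^∨(Q_i,f)·κ^∨(Q_i,g) for all f, g ∈ 𝔱*, i.e. κ_eff^∨ = κ^∨ − Σ_{i=1}^n κ♯(Q_i) ⊗ κ♯(Q_i). -/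
/-- Setting as before: `κ` nondegenerate symmetric on fin.-dim. `𝕥`, `κs = κ♯` inverse of
`κ♭`, roots `Q_i` satisfying the Fundamental Identity, and the effective metric
`κ_eff(x,y) = κ(x,y) + Σ_i Q_i(x)·Q_i(y)` with `κ_eff♭ = keff : 𝕥 → 𝕥*`.

Then: (1) for every `f ∈ 𝕥*`, `κ_eff♭(κ♯(f) - Σ_i κ^∨(Q_i, f) · κ♯(Q_i)) = f`;
(2) in particular `κ_eff♭` is invertible; and (3) the dual form of the effective metric
satisfies `κ_eff^∨(f, g) = κ^∨(f, g) - Σ_i κ^∨(Q_i, f) · κ^∨(Q_i, g)`, i.e. for any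
inverse `keffs` of `κ_eff♭` one has `g (keffs f) = g (κ♯ f) - Σ_i f (κ♯ Q_i) · g (κ♯ Q_i)`. -/
theorem stmt4 {𝕥 : Type*} [AddCommGroup 𝕥] [Module ℂ 𝕥] [FiniteDimensional ℂ 𝕥]
    (κ : 𝕥 →ₗ[ℂ] 𝕥 →ₗ[ℂ] ℂ) (hκsymm : ∀ x y, κ x y = κ y x)
    (hκnd : ∀ x, (∀ y, κ x y = 0) → x = 0)
    (κs : (𝕥 →ₗ[ℂ] ℂ) →ₗ[ℂ] 𝕥) (hκs : ∀ f x, κ (κs f) x = f x)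
    {n : ℕ} (Q : Fin n → (𝕥 →ₗ[ℂ] ℂ)) (hFI : ∀ i j, Q j (κs (Q i)) = 0)
    (keff : 𝕥 →ₗ[ℂ] 𝕥 →ₗ[ℂ] ℂ)
    (hkeff : ∀ x y, keff x y = κ x y + ∑ i : Fin n, Q i x * Q i y) :
    (∀ f : 𝕥 →ₗ[ℂ] ℂ,
        keff (κs f - ∑ i : Fin n, (f (κs (Q i))) • κs (Q i)) = f)
    ∧ Function.Bijective (fun x : 𝕥 => keff x)
    ∧ (∀ keffs : (𝕥 →ₗ[ℂ] ℂ) → 𝕥, (∀ f, keff (keffs f) = f) →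
        ∀ f g : 𝕥 →ₗ[ℂ] ℂ,
          g (keffs f) = g (κs f) - ∑ i : Fin n, f (κs (Q i)) * g (κs (Q i))) := by
  have dual_symm : ∀ f g : 𝕥 →ₗ[ℂ] ℂ, g (κs f) = f (κs g) := fun f g => by
    rw [← hκs g, hκsymm, hκs]
  have keff_sharp : ∀ f : 𝕥 →ₗ[ℂ] ℂ,
      keff (κs f - ∑ i : Fin n, (f (κs (Q i))) • κs (Q i)) = f := fun f => by
    ext y
    simp [hkeff, hκs, hFI, dual_symm f]
  have keff_injective : Function.Injective (fun x : 𝕥 => keff x) := by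
    refine (injective_iff_map_eq_zero keff).2 fun x hx => ?_
    have hQ : ∀ j, Q j x = 0 := fun j => by
      have h := hkeff x (κs (Q j))
      simpa [hx, hFI, hκsymm x, hκs] using h.symm
    refine hκnd x fun y => ?_
    simpa [hx, hQ] using (hkeff x y).symm
  refine ⟨keff_sharp, ⟨keff_injective, fun f => ⟨_, keff_sharp f⟩⟩, fun keffs hkeffs f g => ?_⟩
  rw [keff_injective ((hkeffs f).trans (keff_sharp f).symm)]
  simp
end

section
/- For each 1 ≤ i ≤ n one has κ_eff♭(κ♯(Q_i)) = Q_i; equivalently, the dual effective metric satisfies κ_eff^∨(Q_i, λ) = κ^∨(Q_i, λ) = χ_i(λ) for every λ ∈ 𝔱*. -/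
/-- Setting as before: `κ` nondegenerate symmetric on fin.-dim. `𝕥`, `κs = κ♯` inverse of
`κ♭`, roots `Q_i` with the Fundamental Identity, effective metric
`κ_eff(x,y) = κ(x,y) + Σ_i Q_i(x)·Q_i(y)` with `κ_eff♭ = keff`.

Then for each `i`: `κ_eff♭ (κ♯ (Q_i)) = Q_i`; equivalently, for any two-sided inverse
`keffs` of `κ_eff♭`, the dual effective metric satisfies
`κ_eff^∨(Q_i, λ) = λ (keffs (Q_i)) = λ (κ♯ (Q_i)) = κ^∨(Q_i, λ) = χ_i(λ)` for all `λ`. -/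
theorem stmt5 {𝕥 : Type*} [AddCommGroup 𝕥] [Module ℂ 𝕥] [FiniteDimensional ℂ 𝕥]
    (κ : 𝕥 →ₗ[ℂ] 𝕥 →ₗ[ℂ] ℂ) (hκsymm : ∀ x y, κ x y = κ y x)
    (hκnd : ∀ x, (∀ y, κ x y = 0) → x = 0)
    (κs : (𝕥 →ₗ[ℂ] ℂ) →ₗ[ℂ] 𝕥) (hκs : ∀ f x, κ (κs f) x = f x)
    {n : ℕ} (Q : Fin n → (𝕥 →ₗ[ℂ] ℂ)) (hFI : ∀ i j, Q j (κs (Q i)) = 0)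
    (keff : 𝕥 →ₗ[ℂ] 𝕥 →ₗ[ℂ] ℂ)
    (hkeff : ∀ x y, keff x y = κ x y + ∑ i : Fin n, Q i x * Q i y) :
    (∀ i : Fin n, keff (κs (Q i)) = Q i)
    ∧ (∀ keffs : (𝕥 →ₗ[ℂ] ℂ) → 𝕥, (∀ f, keff (keffs f) = f) →
        (∀ x, keffs (keff x) = x) →
        ∀ (i : Fin n) (lam : 𝕥 →ₗ[ℂ] ℂ), lam (keffs (Q i)) = lam (κs (Q i))) := by
  have hQ : ∀ i : Fin n, keff (κs (Q i)) = Q i := fun i ↦ by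
    ext x
    simp [hkeff, hκs, hFI]
  refine ⟨hQ, fun keffs _ hleft i lam ↦ ?_⟩
  rw [← hleft (κs (Q i)), hQ]
end

section
/- Fix a nonzero i ∈ {1,…,n} and Z ∈ 𝔱 with Q_i(Z) ≠ 0. Set 𝒵 = κ♯(Q_i) and Z′ = Q_i(Z)⁻¹·Z − (κ(Z,Z)/(2·Q_i(Z)²))·𝒵. Then Q_i(Z′) = 1, κ(Z′,Z′) = 0, κ(Z′,𝒵) = 1 and κ(𝒵,𝒵) = 0; in particular 𝒵 ≠ 0, and the restriction of κ to the span of {Z′, 𝒵} is a hyperbolic plane (the metric of the Cartan subalgebra of 𝔤𝔩(1|1) with its supertrace form). -/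
/-- Setting as before: `κ` nondegenerate symmetric on fin.-dim. `𝕥`, `κs = κ♯`,
roots `Q_i` with the Fundamental Identity.  Fix `i` and `Z ∈ 𝕥` with `Q_i(Z) ≠ 0`,
set `𝒵 = κ♯(Q_i)` and `Z' = Q_i(Z)⁻¹ • Z - (κ(Z,Z)/(2·Q_i(Z)²)) • 𝒵`.
Then `Q_i(Z') = 1`, `κ(Z',Z') = 0`, `κ(Z',𝒵) = 1`, `κ(𝒵,𝒵) = 0` and `𝒵 ≠ 0`,
so `κ` restricted to `span {Z', 𝒵}` is a hyperbolic plane (the Cartan metric of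
`𝔤𝔩(1|1)` with its supertrace form). -/
theorem stmt6 {𝕥 : Type*} [AddCommGroup 𝕥] [Module ℂ 𝕥] [FiniteDimensional ℂ 𝕥]
    (κ : 𝕥 →ₗ[ℂ] 𝕥 →ₗ[ℂ] ℂ) (hκsymm : ∀ x y, κ x y = κ y x)
    (hκnd : ∀ x, (∀ y, κ x y = 0) → x = 0)
    (κs : (𝕥 →ₗ[ℂ] ℂ) →ₗ[ℂ] 𝕥) (hκs : ∀ f x, κ (κs f) x = f x)
    {n : ℕ} (Q : Fin n → (𝕥 →ₗ[ℂ] ℂ)) (hFI : ∀ i j, Q j (κs (Q i)) = 0)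
    (i : Fin n) (Z : 𝕥) (hZ : Q i Z ≠ 0)
    (𝒵 Z' : 𝕥) (h𝒵 : 𝒵 = κs (Q i))
    (hZ' : Z' = (Q i Z)⁻¹ • Z - (κ Z Z / (2 * (Q i Z) ^ 2)) • 𝒵) :
    Q i Z' = 1 ∧ κ Z' Z' = 0 ∧ κ Z' 𝒵 = 1 ∧ κ 𝒵 𝒵 = 0 ∧ 𝒵 ≠ 0 := by
  have h𝒵x : ∀ x, κ 𝒵 x = Q i x := fun x => by rw [h𝒵, hκs]
  have hx𝒵 : ∀ x, κ x 𝒵 = Q i x := fun x => by rw [hκsymm, h𝒵x]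
  have hQ𝒵 : Q i 𝒵 = 0 := by rw [h𝒵, hFI]
  have hQZ' : Q i Z' = 1 := by simp [hZ', hQ𝒵, hZ]
  refine ⟨hQZ', ?_, by rw [hx𝒵, hQZ'], by rw [h𝒵x, hQ𝒵], ?_⟩
  · rw [hZ']
    simp only [map_sub, map_smul, LinearMap.sub_apply, LinearMap.smul_apply, smul_eq_mul,
      h𝒵x, hx𝒵, hQ𝒵]
    field_simp
    ring
  · intro h
    apply hZ
    rw [← h𝒵x, h, map_zero, LinearMap.zero_apply]
end

section
/- Let n ≥ 1 and let χ : V → ℂⁿ be a linear map on a complex vector space V each of whose coordinate functionals χ_i = pr_i ∘ χ is nonzero. Let H = χ(V) ⊆ ℂⁿ, fix c ∈ ℂ with c ≠ 0, and set Y = { ξ ∈ H : ξ_i ∈ c·ℤ for some 1 ≤ i ≤ n }. Then Y is a symmetric subset of the additive group H and Y is small in H: for any h_1, …, h_m ∈ H, the union ⋃_{j=1}^m (h_j + Y) is a proper subset of H. -/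
/-- Let `n ≥ 1` and `χ : V → ℂⁿ` a linear map on a complex vector space whose coordinate
functionals `χ_i` are all nonzero.  Let `H = χ(V) ⊆ ℂⁿ`, `c ≠ 0`, and
`Y = {ξ ∈ H : ξ_i ∈ c·ℤ for some i}`.  Then `Y` is a symmetric subset of the additive
group `H` and `Y` is small in `H`: no finite union of translates of `Y` covers `H`. -/
theorem stmt8 {V : Type*} [AddCommGroup V] [Module ℂ V]
    {n : ℕ} (hn : 1 ≤ n) (χ : V →ₗ[ℂ] (Fin n → ℂ))
    (hχ : ∀ i : Fin n, ∃ v : V, χ v i ≠ 0)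
    (c : ℂ) (hc : c ≠ 0)
    (Y : Set (LinearMap.range χ))
    (hY : Y = {ξ : LinearMap.range χ |
        ∃ i : Fin n, ∃ m : ℤ, (ξ : Fin n → ℂ) i = c * (m : ℂ)}) :
    (Y = -Y) ∧
      ∀ (m : ℕ) (h : Fin m → LinearMap.range χ),
        (⋃ j, (fun ξ => h j + ξ) '' Y) ≠ Set.univ := by
  subst hY
  refine ⟨?_, fun m h hcover => ?_⟩
  · ext ξ
    simp only [Set.mem_neg, Set.mem_ofPred_eq, Submodule.coe_neg, Pi.neg_apply]
    constructor
    · rintro ⟨i, k, hk⟩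
      exact ⟨i, -k, by rw [hk]; push_cast; ring⟩
    · rintro ⟨i, k, hk⟩
      exact ⟨i, -k, by rw [← neg_neg ((ξ : Fin n → ℂ) i), hk]; push_cast; ring⟩
  · obtain ⟨v, hv⟩ : ∃ v : V, ∀ i, χ v i ≠ 0 :=
      Module.Dual.exists_forall_ne_zero_of_forall_exists
        (fun i => (LinearMap.proj i).comp χ) hχ
    have hcount : (Set.range fun p : Fin m × Fin n × ℤ =>
        ((h p.1 : Fin n → ℂ) p.2.1 + c * (p.2.2 : ℂ)) / χ v p.2.1).Countable :=
      Set.countable_range _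
    refine not_countable_complex (hcount.mono fun t _ => ?_)
    have ht : (⟨χ (t • v), t • v, rfl⟩ : LinearMap.range χ) ∈ (Set.univ : Set _) :=
      Set.mem_univ _
    rw [← hcover, Set.mem_iUnion] at ht
    obtain ⟨j, ξ, ⟨i, k, hk⟩, hξ⟩ := ht
    refine ⟨(j, i, k), ?_⟩
    have hi := congrFun (congrArg Subtype.val hξ) i
    simp only [Submodule.coe_add, Pi.add_apply, map_smul, Pi.smul_apply, smul_eq_mul, hk] at hi
    exact (div_eq_iff (hv i)).2 hi
end
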